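/- Let A and B be homogeneous constant-coefficient linear differential operators on ℝ^n of orders k and l respectively (A from W to X, B from V to W), both of constant rank, with ker A(ξ) = im B(ξ) for all ξ ∈ ℝ^n \ {0}, and let f : W → ℝ be Borel measurable and locally bounded. Then for every η ∈ W, every ε > 0, and every smooth ℤ^n-periodic w : ℝ^n → W with A w = 0 and ∫_{[0,1]^n} w dx = 0, there exists v ∈ C_c^∞((0,1)^n, V) such that ∫_{[0,1]^n} f(η + B v(x)) dx ≤ ∫_{[0,1]^n} f(η + w(x)) dx + ε. -/

import Mathlib

open MeasureTheory
open scoped BigOperators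

/-- First-order partial derivative in the `i`-th coordinate direction. -/
noncomputable def pderivI {n : ℕ} {W : Type*} [NormedAddCommGroup W] [NormedSpace ℝ W]
    (i : Fin n) (f : (Fin n → ℝ) → W) : (Fin n → ℝ) → W :=
  fun x => fderiv ℝ f x (Pi.single i 1)

/-- The iterated partial derivative `∂^α` associated to a multi-index `α : Fin n → ℕ`. -/
noncomputable def partialDerivMulti {n : ℕ} {W : Type*} [NormedAddCommGroup W]
    [NormedSpace ℝ W] (α : Fin n → ℕ) (f : (Fin n → ℝ) → W) : (Fin n → ℝ) → W :=
  (List.finRange n).foldr (fun i g => (pderivI i)^[α i] g) f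

/-- The homogeneous constant-coefficient differential operator
`A w = ∑_{|α| = k} A_α ∂^α w`. -/
noncomputable def diffOp {n : ℕ} {W X : Type*} [NormedAddCommGroup W] [NormedSpace ℝ W]
    [NormedAddCommGroup X] [NormedSpace ℝ X]
    (k : ℕ) (coef : (Fin n → ℕ) → (W →ₗ[ℝ] X)) (f : (Fin n → ℝ) → W) : (Fin n → ℝ) → X :=
  fun x => ∑ α ∈ Finset.Nat.antidiagonalTuple n k, coef α (partialDerivMulti α f x)

/-- The symbol `A(ξ) = ∑_{|α| = k} ξ^α A_α` of the operator `diffOp k coef`. -/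
noncomputable def symbolOf {n : ℕ} {W X : Type*} [NormedAddCommGroup W] [NormedSpace ℝ W]
    [NormedAddCommGroup X] [NormedSpace ℝ X]
    (k : ℕ) (coef : (Fin n → ℕ) → (W →ₗ[ℝ] X)) (ξ : Fin n → ℝ) : W →ₗ[ℝ] X :=
  ∑ α ∈ Finset.Nat.antidiagonalTuple n k, (∏ i, ξ i ^ α i) • coef α

/-- The open unit cube `(0,1)^n`. -/
def openUnitCube (n : ℕ) : Set (Fin n → ℝ) := Set.univ.pi fun _ => Set.Ioo (0 : ℝ) 1

section PartialDerivatives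

variable {n : ℕ} {W : Type*} [NormedAddCommGroup W] [NormedSpace ℝ W]

theorem ContDiff.pderivI {f : (Fin n → ℝ) → W} (hf : ContDiff ℝ (⊤ : ℕ∞) f) (i : Fin n) :
    ContDiff ℝ (⊤ : ℕ∞) (pderivI i f) := by
  unfold _root_.pderivI
  exact (hf.fderiv_right (m := (⊤ : ℕ∞)) (by simp)).clm_apply contDiff_const

theorem norm_iteratedFDeriv_pderivI_le {f : (Fin n → ℝ) → W} (hf : ContDiff ℝ (⊤ : ℕ∞) f)
    (i : Fin n) (j : ℕ) (x : Fin n → ℝ) :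
    ‖iteratedFDeriv ℝ j (pderivI i f) x‖ ≤ ‖iteratedFDeriv ℝ (j + 1) f x‖ := by
  have h := norm_iteratedFDeriv_clm_apply_const (𝕜 := ℝ) (f := fderiv ℝ f)
    (c := Pi.single i (1 : ℝ)) (x := x) (N := (⊤ : ℕ∞)) (n := j)
    (hf.fderiv_right (m := (⊤ : ℕ∞)) (by simp)).contDiffAt (by exact_mod_cast le_top)
  rw [norm_iteratedFDeriv_fderiv] at h
  simpa only [Pi.norm_single, norm_one, one_mul] using! h

/-- Induction principle for iterated partial derivatives of a family of functions. -/
theorem partialDerivMulti_induction {ι : Type*}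
    {P : (Fin n → ℕ) → (ι → (Fin n → ℝ) → W) → Prop} (f : ι → (Fin n → ℝ) → W) (h0 : P 0 f)
    (hs : ∀ α i g, P α g → P (α + Pi.single i 1) (fun j => pderivI i (g j))) (α : Fin n → ℕ) :
    P α (fun j => partialDerivMulti α (f j)) := by
  have hiter : ∀ (i : Fin n) (p : ℕ) (β : Fin n → ℕ) (g : ι → (Fin n → ℝ) → W), P β g →
      P (β + Pi.single i p) (fun j => (pderivI i)^[p] (g j)) := by
    intro i p β g hg
    induction p with
    | zero => simpa using hg
    | succ p ih =>
      simp only [Function.iterate_succ_apply', Pi.single_add, ← add_assoc]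
      exact hs _ i _ ih
  have hlist : ∀ L : List (Fin n), L.Nodup →
      P (fun i => if i ∈ L then α i else 0)
        (fun j => L.foldr (fun i g => (pderivI i)^[α i] g) (f j)) := by
    intro L hL
    induction L with
    | nil => simpa using! h0
    | cons i L ih =>
      have hi := hiter i (α i) _ _ (ih hL.of_cons)
      have hα : (fun k => if k ∈ i :: L then α k else 0) =
          (fun k => if k ∈ L then α k else 0) + Pi.single i (α i) := by
        ext k
        by_cases hk : k = i
        · subst hk
          simp [(List.nodup_cons.1 hL).1]
        · simp [hk]
      rw [hα]
      exact hi
  simpa using! hlist _ (List.nodup_finRange n)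

theorem partialDerivMulti_induction_single
    {P : (Fin n → ℕ) → ((Fin n → ℝ) → W) → Prop} (f : (Fin n → ℝ) → W) (h0 : P 0 f)
    (hs : ∀ α i g, P α g → P (α + Pi.single i 1) (pderivI i g)) (α : Fin n → ℕ) :
    P α (partialDerivMulti α f) :=
  partialDerivMulti_induction (ι := Unit) (P := fun α g => P α (g ())) (fun _ => f) h0
    (fun α i g => hs α i (g ())) α

theorem ContDiff.partialDerivMulti {f : (Fin n → ℝ) → W} (hf : ContDiff ℝ (⊤ : ℕ∞) f)
    (α : Fin n → ℕ) : ContDiff ℝ (⊤ : ℕ∞) (partialDerivMulti α f) :=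
  partialDerivMulti_induction_single (P := fun _ g => ContDiff ℝ (⊤ : ℕ∞) g) f hf
    (fun _ i _ hg => hg.pderivI i) α

variable {X : Type*} [NormedAddCommGroup X] [NormedSpace ℝ X]

theorem diffOp_eq_of_eventuallyEq (k : ℕ) (coef : (Fin n → ℕ) → (W →ₗ[ℝ] X))
    {f g : (Fin n → ℝ) → W} {x : Fin n → ℝ} (h : f =ᶠ[nhds x] g) :
    diffOp k coef f x = diffOp k coef g x := by
  have key : ∀ α, partialDerivMulti α f =ᶠ[nhds x] partialDerivMulti α g := fun α =>
    partialDerivMulti_induction (ι := Bool)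
      (P := fun _ u => u true =ᶠ[nhds x] u false) (fun b => if b then f else g) (by simpa using h)
      (fun _ i u hu => by
        filter_upwards [hu.fderiv (𝕜 := ℝ)] with y hy
        simp [_root_.pderivI, hy]) α
  simp only [diffOp]
  exact Finset.sum_congr rfl fun α _ => by rw [(key α).eq_of_nhds]

theorem ContDiff.diffOp [FiniteDimensional ℝ W] {f : (Fin n → ℝ) → W}
    (hf : ContDiff ℝ (⊤ : ℕ∞) f) (k : ℕ) (coef : (Fin n → ℕ) → (W →ₗ[ℝ] X)) :
    ContDiff ℝ (⊤ : ℕ∞) (diffOp k coef f) := by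
  unfold _root_.diffOp
  exact ContDiff.sum fun α _ =>
    (LinearMap.toContinuousLinearMap (coef α)).contDiff.comp (hf.partialDerivMulti α)

theorem diffOp_comp_smul (k : ℕ) (coef : (Fin n → ℕ) → (W →ₗ[ℝ] X)) {f : (Fin n → ℝ) → W}
    (hf : ContDiff ℝ (⊤ : ℕ∞) f) (b c : ℝ) (x : Fin n → ℝ) :
    diffOp k coef (fun y => b • f (c • y)) x = (b * c ^ k) • diffOp k coef f (c • x) := by
  have key : ∀ α, ContDiff ℝ (⊤ : ℕ∞) (partialDerivMulti α f) ∧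
      partialDerivMulti α (fun y => b • f (c • y)) =
        fun y => (b * c ^ (∑ i, α i)) • partialDerivMulti α f (c • y) := fun α =>
    partialDerivMulti_induction (ι := Bool)
      (P := fun α u => ContDiff ℝ (⊤ : ℕ∞) (u true) ∧
        u false = fun y => (b * c ^ (∑ i, α i)) • u true (c • y))
      (fun t => if t then f else (fun y => b • f (c • y))) (by simpa using hf)
      (fun α i u hu => by
        refine ⟨hu.1.pderivI i, ?_⟩
        ext y
        have hd : DifferentiableAt ℝ (fun y => u true (c • y)) y :=
          ((hu.1.differentiable (by simp)).comp (differentiable_id.const_smul c)) y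
        have hsum : ∑ j, (α + Pi.single i 1 : Fin n → ℕ) j = ∑ j, α j + 1 := by
          simp [Finset.sum_add_distrib]
        rw [hsum]
        simp only [hu.2, _root_.pderivI]
        rw [fderiv_fun_const_smul hd, fderiv_comp_smul]
        simp [smul_smul, pow_succ, mul_assoc]) α
  simp only [_root_.diffOp, Finset.smul_sum]
  refine Finset.sum_congr rfl fun α hα => ?_
  rw [Finset.Nat.mem_antidiagonalTuple] at hα
  rw [(key α).2, hα, map_smul]

end PartialDerivatives

section Moments

variable {n : ℕ} {J W : Type*} [NormedAddCommGroup W] {ξ : J → Fin n → ℝ} {a : J → W}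

/-- All moments of the amplitudes `a` with respect to the frequencies `ξ` are finite. -/
def SummableMoments (ξ : J → Fin n → ℝ) (a : J → W) : Prop :=
  ∀ p : ℕ, Summable fun j => ‖ξ j‖ ^ p * ‖a j‖

theorem SummableMoments.of_norm_le {V : Type*} [NormedAddCommGroup V] (h : SummableMoments ξ a) {b : J → V}
    {C : ℝ} (hb : ∀ j, ‖b j‖ ≤ C * ‖a j‖) (p : ℕ) : Summable fun j => ‖ξ j‖ ^ p * ‖b j‖ := by
  refine ((h p).mul_left C).of_nonneg_of_le (fun j => by positivity) fun j => ?_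
  calc ‖ξ j‖ ^ p * ‖b j‖ ≤ ‖ξ j‖ ^ p * (C * ‖a j‖) := by gcongr; exact hb j
    _ = C * (‖ξ j‖ ^ p * ‖a j‖) := by ring

theorem SummableMoments.summable_iteratedFDeriv (h : SummableMoments ξ a) (p : ℕ) :
    Summable fun j => (n * ‖ξ j‖) ^ p * ‖a j‖ := by
  simpa [mul_pow, mul_assoc] using (h p).mul_left ((n : ℝ) ^ p)

end Moments

section PlaneWaves

variable {n : ℕ} {W : Type*} [NormedAddCommGroup W] [NormedSpace ℝ W]

/-- The real plane wave `x ↦ cos (ξ · x + c) a`. -/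
noncomputable def planeWave (ξ : Fin n → ℝ) (c : ℝ) (a : W) : (Fin n → ℝ) → W :=
  fun x => Real.cos (ξ ⬝ᵥ x + c) • a

/-- The linear functional `x ↦ ξ · x`. -/
noncomputable def dotProductCLM (ξ : Fin n → ℝ) : (Fin n → ℝ) →L[ℝ] ℝ :=
  ∑ i, ξ i • ContinuousLinearMap.proj i

@[simp]
theorem dotProductCLM_apply (ξ x : Fin n → ℝ) : dotProductCLM ξ x = ξ ⬝ᵥ x := by
  simp [dotProductCLM, dotProduct]

theorem norm_dotProductCLM_le (ξ : Fin n → ℝ) : ‖dotProductCLM ξ‖ ≤ n * ‖ξ‖ := by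
  refine ContinuousLinearMap.opNorm_le_bound _ (by positivity) fun x => ?_
  rw [dotProductCLM_apply, dotProduct]
  calc ‖∑ i, ξ i * x i‖ ≤ ∑ i : Fin n, ‖ξ‖ * ‖x‖ := norm_sum_le_of_le _ fun i _ => by
        rw [norm_mul]
        exact mul_le_mul (norm_le_pi_norm ξ i) (norm_le_pi_norm x i) (norm_nonneg _) (norm_nonneg _)
    _ = n * ‖ξ‖ * ‖x‖ := by simp [mul_assoc]

theorem contDiff_planeWave (ξ : Fin n → ℝ) (c : ℝ) (a : W) :
    ContDiff ℝ (⊤ : ℕ∞) (planeWave ξ c a) := by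
  have : planeWave ξ c a = fun x => Real.cos (dotProductCLM ξ x + c) • a := by
    ext x; simp [planeWave]
  rw [this]
  exact ((Real.contDiff_cos.comp ((dotProductCLM ξ).contDiff.add contDiff_const))).smul
    contDiff_const

theorem pderivI_planeWave (ξ : Fin n → ℝ) (c : ℝ) (a : W) (i : Fin n) :
    pderivI i (planeWave ξ c a) = planeWave ξ (c + Real.pi / 2) (ξ i • a) := by
  ext x
  have h : HasFDerivAt (planeWave ξ c a)
      ((-Real.sin (ξ ⬝ᵥ x + c) • dotProductCLM ξ).smulRight a) x := by
    have h1 : HasFDerivAt (fun y => ξ ⬝ᵥ y + c) (dotProductCLM ξ) x := by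
      simpa using (dotProductCLM ξ).hasFDerivAt (x := x) |>.add_const c
    exact h1.cos.smul_const a
  simp [pderivI, h.fderiv, planeWave, ← add_assoc, Real.cos_add_pi_div_two, smul_smul]

theorem norm_iteratedFDeriv_planeWave_le (ξ : Fin n → ℝ) (c : ℝ) (a : W) (p : ℕ)
    (x : Fin n → ℝ) : ‖iteratedFDeriv ℝ p (planeWave ξ c a) x‖ ≤ (n * ‖ξ‖) ^ p * ‖a‖ := by
  have hcos : ContDiff ℝ (⊤ : ℕ∞) (fun t : ℝ => Real.cos (t + c)) :=
    Real.contDiff_cos.comp (contDiff_id.add contDiff_const)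
  have hp : (p : WithTop ℕ∞) ≤ ((⊤ : ℕ∞) : WithTop ℕ∞) := by exact_mod_cast le_top
  have hcomp : planeWave ξ c a =
      (((ContinuousLinearMap.id ℝ ℝ).smulRight a) ∘ (fun t : ℝ => Real.cos (t + c))) ∘
        dotProductCLM ξ := by
    ext y; simp [planeWave]
  rw [hcomp, (dotProductCLM ξ).iteratedFDeriv_comp_right
    ((ContinuousLinearMap.contDiff _).comp hcos) x hp]
  refine (ContinuousMultilinearMap.norm_compContinuousLinearMap_le _ _).trans ?_
  rw [Finset.prod_const, Finset.card_univ, Fintype.card_fin, mul_comm]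
  refine mul_le_mul (pow_le_pow_left₀ (norm_nonneg _) (norm_dotProductCLM_le ξ) p) ?_
    (norm_nonneg _) (by positivity)
  rw [ContinuousLinearMap.iteratedFDeriv_comp_left _ hcos.contDiffAt hp]
  refine (ContinuousLinearMap.norm_compContinuousMultilinearMap_le _ _).trans ?_
  have h1 : ‖iteratedFDeriv ℝ p (fun t : ℝ => Real.cos (t + c)) (dotProductCLM ξ x)‖ ≤ 1 := by
    rw [iteratedFDeriv_comp_add_right p c, norm_iteratedFDeriv_eq_norm_iteratedDeriv]
    exact Real.abs_iteratedDeriv_cos_le_one _ _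
  have h2 : ‖(ContinuousLinearMap.id ℝ ℝ).smulRight a‖ ≤ ‖a‖ :=
    ContinuousLinearMap.opNorm_le_bound _ (norm_nonneg _) fun t => by
      simp [norm_smul, mul_comm]
  calc _ ≤ ‖a‖ * 1 := mul_le_mul h2 h1 (norm_nonneg _) (norm_nonneg _)
    _ = ‖a‖ := mul_one _

/-- The sum of the plane waves with frequencies `ξ j`, phases `c j` and amplitudes `a j`. -/
noncomputable def waveSeries {J : Type*} (ξ : J → Fin n → ℝ) (c : J → ℝ) (a : J → W) :
    (Fin n → ℝ) → W :=
  fun x => ∑' j, planeWave (ξ j) (c j) (a j) x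

namespace SummableMoments

variable {J : Type*} {ξ : J → Fin n → ℝ} {a : J → W}

theorem smul_apply (h : SummableMoments ξ a) (i : Fin n) :
    SummableMoments ξ fun j => ξ j i • a j := fun p => by
  refine (h (p + 1)).of_nonneg_of_le (fun j => by positivity) fun j => ?_
  rw [norm_smul, pow_succ, mul_assoc]
  gcongr
  exact norm_le_pi_norm (ξ j) i

variable [CompleteSpace W]

theorem summable_planeWave (h : SummableMoments ξ a) (c : J → ℝ) (x : Fin n → ℝ) :
    Summable fun j => planeWave (ξ j) (c j) (a j) x :=
  .of_norm_bounded (h.summable_iteratedFDeriv 0) fun j => by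
    simpa using norm_iteratedFDeriv_planeWave_le (ξ j) (c j) (a j) 0 x

theorem contDiff_waveSeries (h : SummableMoments ξ a) (c : J → ℝ) :
    ContDiff ℝ (⊤ : ℕ∞) (waveSeries ξ c a) :=
  contDiff_tsum (N := ⊤) (fun j => contDiff_planeWave (ξ j) (c j) (a j))
    (fun p _ => h.summable_iteratedFDeriv p)
    (fun p j x _ => norm_iteratedFDeriv_planeWave_le (ξ j) (c j) (a j) p x)

theorem norm_iteratedFDeriv_waveSeries_le (h : SummableMoments ξ a) (c : J → ℝ) (p : ℕ)
    (x : Fin n → ℝ) :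
    ‖iteratedFDeriv ℝ p (waveSeries ξ c a) x‖ ≤ ∑' j, (n * ‖ξ j‖) ^ p * ‖a j‖ := by
  unfold waveSeries
  rw [iteratedFDeriv_tsum_apply (N := ⊤) (fun j => contDiff_planeWave (ξ j) (c j) (a j))
    (fun p _ => h.summable_iteratedFDeriv p)
    (fun p j x _ => norm_iteratedFDeriv_planeWave_le (ξ j) (c j) (a j) p x) le_top]
  exact tsum_of_norm_bounded (h.summable_iteratedFDeriv p).hasSum
    fun j => norm_iteratedFDeriv_planeWave_le (ξ j) (c j) (a j) p x

theorem pderivI_waveSeries (h : SummableMoments ξ a) (c : J → ℝ) (i : Fin n) :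
    pderivI i (waveSeries ξ c a) =
      waveSeries ξ (fun j => c j + Real.pi / 2) (fun j => ξ j i • a j) := by
  have hb : ∀ j x, ‖fderiv ℝ (planeWave (ξ j) (c j) (a j)) x‖ ≤ (n * ‖ξ j‖) ^ 1 * ‖a j‖ := by
    intro j x
    rw [← norm_iteratedFDeriv_one]
    exact norm_iteratedFDeriv_planeWave_le (ξ j) (c j) (a j) 1 x
  ext x
  simp only [pderivI]
  unfold waveSeries
  rw [fderiv_tsum_apply (h.summable_iteratedFDeriv 1)
    (fun j => (contDiff_planeWave (ξ j) (c j) (a j)).differentiable (by simp)) hb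
    (h.summable_planeWave c 0) x]
  have hs : Summable fun j => fderiv ℝ (planeWave (ξ j) (c j) (a j)) x :=
    .of_norm_bounded (h.summable_iteratedFDeriv 1) fun j => hb j x
  refine ((ContinuousLinearMap.apply ℝ W (Pi.single i (1 : ℝ) : Fin n → ℝ)).map_tsum hs).trans ?_
  refine tsum_congr fun j => ?_
  rw [← pderivI_planeWave]
  rfl

theorem partialDerivMulti_waveSeries (h : SummableMoments ξ a) (c : J → ℝ) (α : Fin n → ℕ) :
    SummableMoments ξ (fun j => (∏ i, ξ j i ^ α i) • a j) ∧
      partialDerivMulti α (waveSeries ξ c a) =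
        waveSeries ξ (fun j => c j + (∑ i, α i : ℕ) * (Real.pi / 2))
          (fun j => (∏ i, ξ j i ^ α i) • a j) :=
  partialDerivMulti_induction_single
    (P := fun α g => SummableMoments ξ (fun j => (∏ i, ξ j i ^ α i) • a j) ∧
      g = waveSeries ξ (fun j => c j + (∑ i, α i : ℕ) * (Real.pi / 2))
          (fun j => (∏ i, ξ j i ^ α i) • a j)) _ (by simpa using h)
    (fun α i g hg => by
      have hsum : ∑ j, (α + Pi.single i 1 : Fin n → ℕ) j = ∑ j, α j + 1 := by
        simp [Finset.sum_add_distrib]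
      have hprod : ∀ j, ∏ l, ξ j l ^ (α + Pi.single i 1 : Fin n → ℕ) l =
          ξ j i * ∏ l, ξ j l ^ α l := by
        intro j
        simp only [Pi.add_apply, pow_add, Finset.prod_mul_distrib]
        rw [mul_comm, Finset.prod_eq_single i (by intro b _ hb; simp [hb]) (by simp)]
        simp
      simp only [hsum, hprod, mul_smul]
      refine ⟨hg.1.smul_apply i, ?_⟩
      rw [hg.2, hg.1.pderivI_waveSeries]
      congr 1
      ext j
      push_cast
      ring) α

variable {X : Type*} [NormedAddCommGroup X] [NormedSpace ℝ X]

theorem diffOp_waveSeries [FiniteDimensional ℝ W] (h : SummableMoments ξ a) (c : J → ℝ) (k : ℕ)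
    (coef : (Fin n → ℕ) → (W →ₗ[ℝ] X)) :
    diffOp k coef (waveSeries ξ c a) =
      waveSeries ξ (fun j => c j + k * (Real.pi / 2)) (fun j => symbolOf k coef (ξ j) (a j)) := by
  ext x
  have key : ∀ α ∈ Finset.Nat.antidiagonalTuple n k,
      HasSum (fun j => planeWave (ξ j) (c j + k * (Real.pi / 2))
        (coef α ((∏ i, ξ j i ^ α i) • a j)) x)
        (coef α (partialDerivMulti α (waveSeries ξ c a) x)) := by
    intro α hα
    rw [Finset.Nat.mem_antidiagonalTuple] at hα
    obtain ⟨h1, h2⟩ := h.partialDerivMulti_waveSeries c α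
    rw [h2, hα]
    have h3 := (LinearMap.toContinuousLinearMap (coef α)).hasSum
      (h1.summable_planeWave (fun j => c j + k * (Real.pi / 2)) x).hasSum
    simpa [planeWave, Function.comp_def, waveSeries] using h3
  have := hasSum_sum key
  simp only [diffOp, waveSeries]
  rw [← this.tsum_eq]
  refine tsum_congr fun j => ?_
  simp [planeWave, symbolOf, Finset.smul_sum]

end SummableMoments

end PlaneWaves

section FourierCoefficients

/-- A function on `ℝ^n` is `ℤ^n`-periodic. -/
def IsIntPeriodic {n : ℕ} {α : Type*} (f : (Fin n → ℝ) → α) : Prop :=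
  ∀ (x : Fin n → ℝ) (z : Fin n → ℤ), f (x + fun i => (z i : ℝ)) = f x

/-- The frequency `2πm` of the lattice point `m`. -/
noncomputable def latticeFreq {n : ℕ} (m : Fin n → ℤ) : Fin n → ℝ := fun i => 2 * Real.pi * m i

variable {n : ℕ} {W : Type*} [NormedAddCommGroup W] [NormedSpace ℝ W]

theorem IsIntPeriodic.pderivI {f : (Fin n → ℝ) → W} (hf : IsIntPeriodic f) (i : Fin n) :
    IsIntPeriodic (pderivI i f) := by
  intro x z
  have h : (fun y => f (y + fun i => (z i : ℝ))) = f := funext fun y => hf y z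
  simp only [_root_.pderivI]
  rw [← fderiv_comp_add_right, h]

theorem isIntPeriodic_cos_latticeFreq (m : Fin n → ℤ) (c : ℝ) :
    IsIntPeriodic fun x => Real.cos (latticeFreq m ⬝ᵥ x + c) := by
  intro x z
  have h : latticeFreq m ⬝ᵥ (x + fun i => (z i : ℝ)) + c =
      latticeFreq m ⬝ᵥ x + c + ((∑ i, m i * z i : ℤ) : ℝ) * (2 * Real.pi) := by
    rw [dotProduct_add]
    have : latticeFreq m ⬝ᵥ (fun i => (z i : ℝ)) = ((∑ i, m i * z i : ℤ) : ℝ) * (2 * Real.pi) := by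
      simp only [dotProduct, latticeFreq]
      push_cast
      rw [Finset.sum_mul]
      exact Finset.sum_congr rfl fun i _ => by ring
    rw [this]; ring
  simp only [h, Real.cos_add_int_mul_two_pi]

theorem setIntegral_pderivI_eq_zero {f : (Fin n → ℝ) → W} (hf : ContDiff ℝ (⊤ : ℕ∞) f)
    (hper : IsIntPeriodic f) (i : Fin n) : ∫ x in Set.Icc (0 : Fin n → ℝ) 1, pderivI i f x = 0 := by
  obtain ⟨n, rfl⟩ : ∃ n', n = n' + 1 := ⟨n - 1, by have := i.pos; omega⟩
  have hc : Continuous (pderivI i f) := (hf.pderivI i).continuous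
  have hsum : ∀ x, ∑ j, (Pi.single i (fderiv ℝ f) : Fin (n + 1) → _ → _ →L[ℝ] W) j x
      (Pi.single j 1) = pderivI i f x := by
    intro x
    rw [Finset.sum_eq_single i (by intro b _ hb; simp [hb]) (by simp)]
    simp [pderivI]
  have h := integral_divergence_of_hasFDerivAt_off_countable' (E := W) (0 : Fin (n + 1) → ℝ) 1
    (by intro j; simp) (Pi.single i f) (Pi.single i (fderiv ℝ f)) ∅ Set.countable_empty
    (fun j => by
      by_cases hj : j = i
      · subst hj; simpa using hf.continuous.continuousOn
      · simpa [hj] using! continuousOn_const)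
    (fun x _ j => by
      by_cases hj : j = i
      · subst hj; simpa using (hf.differentiable (by simp) x).hasFDerivAt
      · simpa [hj] using! hasFDerivAt_const (0 : W) x)
    (by simp only [hsum]; exact hc.continuousOn.integrableOn_compact isCompact_Icc)
  simp only [hsum] at h
  rw [h]
  refine Finset.sum_eq_zero fun j _ => ?_
  by_cases hj : j = i
  · subst hj
    rw [sub_eq_zero]
    congr 1
    ext y
    simp only [Pi.single_eq_same]
    rw [← hper (j.insertNth ((0 : Fin (n + 1) → ℝ) j) y) (Pi.single j 1)]
    congr 1
    ext l
    refine Fin.succAboveCases j ?_ (fun l => ?_) l <;> simp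
  · simp [hj]

/-- The integral of `w` against the wave `x ↦ cos (ξ · x + c)` over the unit cube. -/
noncomputable def waveCoeff (w : (Fin n → ℝ) → W) (ξ : Fin n → ℝ) (c : ℝ) : W :=
  ∫ x in Set.Icc (0 : Fin n → ℝ) 1, Real.cos (ξ ⬝ᵥ x + c) • w x

theorem continuous_cos_dotProduct (ξ : Fin n → ℝ) (c : ℝ) :
    Continuous fun x => Real.cos (ξ ⬝ᵥ x + c) := by
  simp only [← dotProductCLM_apply]
  fun_prop

theorem integrableOn_cos_smul {w : (Fin n → ℝ) → W} (hw : Continuous w) (ξ : Fin n → ℝ) (c : ℝ) :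
    IntegrableOn (fun x => Real.cos (ξ ⬝ᵥ x + c) • w x) (Set.Icc (0 : Fin n → ℝ) 1) :=
  ((continuous_cos_dotProduct ξ c).smul hw).continuousOn.integrableOn_compact isCompact_Icc

theorem norm_waveCoeff_le {w : (Fin n → ℝ) → W} {C : ℝ}
    (hC : ∀ x ∈ Set.Icc (0 : Fin n → ℝ) 1, ‖w x‖ ≤ C) (ξ : Fin n → ℝ) (c : ℝ) :
    ‖waveCoeff w ξ c‖ ≤ C := by
  have h := norm_setIntegral_le_of_norm_le_const (μ := volume) (s := Set.Icc (0 : Fin n → ℝ) 1)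
    (f := fun x => Real.cos (ξ ⬝ᵥ x + c) • w x) (C := C) isCompact_Icc.measure_lt_top
    (fun x hx => by
      rw [norm_smul]
      calc _ ≤ 1 * ‖w x‖ := by gcongr; exact Real.abs_cos_le_one _
        _ ≤ C := by rw [one_mul]; exact hC x hx)
  simpa [Measure.real, Real.volume_Icc_pi, waveCoeff] using! h

theorem planeWave_one (ξ : Fin n → ℝ) (c : ℝ) :
    planeWave ξ c (1 : ℝ) = fun x => Real.cos (ξ ⬝ᵥ x + c) := by
  ext x
  simp [planeWave]

theorem waveCoeff_pderivI {w : (Fin n → ℝ) → W} (hw : ContDiff ℝ (⊤ : ℕ∞) w)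
    (hper : IsIntPeriodic w) (m : Fin n → ℤ) (c : ℝ) (i : Fin n) :
    waveCoeff (pderivI i w) (latticeFreq m) c =
      latticeFreq m i • waveCoeff w (latticeFreq m) (c - Real.pi / 2) := by
  set ξ := latticeFreq m
  have hcos : ContDiff ℝ (⊤ : ℕ∞) (fun x => Real.cos (ξ ⬝ᵥ x + c)) := by
    rw [← planeWave_one]
    exact contDiff_planeWave ξ c (1 : ℝ)
  have hd : ∀ x, pderivI i (fun x => Real.cos (ξ ⬝ᵥ x + c) • w x) x =
      Real.cos (ξ ⬝ᵥ x + c) • pderivI i w x -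
        ξ i • Real.cos (ξ ⬝ᵥ x + (c - Real.pi / 2)) • w x := by
    intro x
    have h1 := congrFun (pderivI_planeWave ξ c (1 : ℝ) i) x
    rw [planeWave_one] at h1
    simp only [pderivI, planeWave, smul_eq_mul, mul_one] at h1
    simp only [pderivI]
    rw [fderiv_fun_smul (hcos.differentiable (by simp) x) (hw.differentiable (by simp) x)]
    simp only [add_apply, smul_apply,
      ContinuousLinearMap.smulRight_apply, h1, ← add_assoc, ← add_sub_assoc,
      Real.cos_add_pi_div_two, Real.cos_sub_pi_div_two, smul_smul]
    rw [sub_eq_add_neg, ← neg_smul]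
    congr 2
    ring
  have h0 := setIntegral_pderivI_eq_zero (f := fun x => Real.cos (ξ ⬝ᵥ x + c) • w x)
    (hcos.smul hw) (fun x z => by
      change Real.cos (ξ ⬝ᵥ (x + fun i => (z i : ℝ)) + c) • w (x + fun i => (z i : ℝ)) = _
      rw [hper x z]
      congr 1
      exact isIntPeriodic_cos_latticeFreq m c x z) i
  simp only [hd] at h0
  rw [integral_sub (integrableOn_cos_smul (hw.pderivI i).continuous ξ c)
    (g := fun x => ξ i • Real.cos (ξ ⬝ᵥ x + (c - Real.pi / 2)) • w x)
    ((integrableOn_cos_smul hw.continuous ξ _).smul (ξ i)), integral_smul, sub_eq_zero] at h0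
  exact h0

theorem waveCoeff_partialDerivMulti {w : (Fin n → ℝ) → W} (hw : ContDiff ℝ (⊤ : ℕ∞) w)
    (hper : IsIntPeriodic w) (m : Fin n → ℤ) (α : Fin n → ℕ) (c : ℝ) :
    waveCoeff (partialDerivMulti α w) (latticeFreq m) c =
      (∏ i, latticeFreq m i ^ α i) •
        waveCoeff w (latticeFreq m) (c - (∑ i, α i : ℕ) * (Real.pi / 2)) :=
  (partialDerivMulti_induction_single
    (P := fun α g => ContDiff ℝ (⊤ : ℕ∞) g ∧ IsIntPeriodic g ∧
      ∀ c, waveCoeff g (latticeFreq m) c = (∏ i, latticeFreq m i ^ α i) •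
        waveCoeff w (latticeFreq m) (c - (∑ i, α i : ℕ) * (Real.pi / 2)))
    w ⟨hw, hper, by simp⟩
    (fun α i g ⟨h1, h2, h3⟩ => by
      refine ⟨h1.pderivI i, h2.pderivI i, fun c => ?_⟩
      have hsum : ∑ j, (α + Pi.single i 1 : Fin n → ℕ) j = ∑ j, α j + 1 := by
        simp [Finset.sum_add_distrib]
      have hprod : ∏ l, latticeFreq m l ^ (α + Pi.single i 1 : Fin n → ℕ) l =
          latticeFreq m i * ∏ l, latticeFreq m l ^ α l := by
        simp only [Pi.add_apply, pow_add, Finset.prod_mul_distrib]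
        rw [mul_comm, Finset.prod_eq_single i (by intro b _ hb; simp [hb]) (by simp)]
        simp
      rw [waveCoeff_pderivI h1 h2, h3, hsum, hprod, mul_smul]
      congr 3
      push_cast
      ring) α).2.2 c

theorem waveCoeff_diffOp [FiniteDimensional ℝ W] {X : Type*} [NormedAddCommGroup X]
    [NormedSpace ℝ X] [CompleteSpace X] {w : (Fin n → ℝ) → W} (hw : ContDiff ℝ (⊤ : ℕ∞) w)
    (hper : IsIntPeriodic w) (m : Fin n → ℤ) (k : ℕ) (coef : (Fin n → ℕ) → (W →ₗ[ℝ] X)) (c : ℝ) :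
    waveCoeff (diffOp k coef w) (latticeFreq m) c =
      symbolOf k coef (latticeFreq m) (waveCoeff w (latticeFreq m) (c - k * (Real.pi / 2))) := by
  have hint : ∀ α, IntegrableOn (fun x => Real.cos (latticeFreq m ⬝ᵥ x + c) •
      partialDerivMulti α w x) (Set.Icc (0 : Fin n → ℝ) 1) :=
    fun α => integrableOn_cos_smul (hw.partialDerivMulti α).continuous _ _
  have hrw : ∀ x, Real.cos (latticeFreq m ⬝ᵥ x + c) • diffOp k coef w x =
      ∑ α ∈ Finset.Nat.antidiagonalTuple n k, LinearMap.toContinuousLinearMap (coef α)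
        (Real.cos (latticeFreq m ⬝ᵥ x + c) • partialDerivMulti α w x) := by
    intro x
    simp [diffOp, Finset.smul_sum]
  simp only [waveCoeff, hrw]
  rw [integral_finsetSum _ fun α _ => ContinuousLinearMap.integrable_comp _ (hint α)]
  simp only [symbolOf, LinearMap.sum_apply, LinearMap.smul_apply]
  refine Finset.sum_congr rfl fun α hα => ?_
  rw [Finset.Nat.mem_antidiagonalTuple] at hα
  rw [ContinuousLinearMap.integral_comp_comm _ (hint α)]
  have := waveCoeff_partialDerivMulti hw hper m α c
  simp only [waveCoeff, hα] at this
  rw [this]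
  simp

end FourierCoefficients

section Decay

variable {n : ℕ} {W : Type*} [NormedAddCommGroup W] [NormedSpace ℝ W]

theorem latticeFreq_injective : Function.Injective (latticeFreq (n := n)) := by
  intro m m' h
  ext i
  have := congrFun h i
  simpa [latticeFreq, Real.pi_ne_zero] using this

theorem latticeFreq_eq_zero {m : Fin n → ℤ} : latticeFreq m = 0 ↔ m = 0 := by
  rw [← latticeFreq_injective.eq_iff]
  simp [funext_iff, latticeFreq]

theorem norm_latticeFreq (m : Fin n → ℤ) :
    ‖latticeFreq m‖ = 2 * Real.pi * ‖fun i => (m i : ℝ)‖ := by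
  have : latticeFreq m = (2 * Real.pi) • fun i => (m i : ℝ) := by
    ext i; simp [latticeFreq]
  rw [this, norm_smul, Real.norm_of_nonneg (by positivity)]

theorem one_le_norm_latticeFreq {m : Fin n → ℤ} (hm : m ≠ 0) : 1 ≤ ‖latticeFreq m‖ := by
  obtain ⟨i, hi⟩ := Function.ne_iff.mp hm
  have h1 : (1 : ℝ) ≤ |(m i : ℝ)| := by exact_mod_cast Int.one_le_abs hi
  refine le_trans ?_ (norm_le_pi_norm _ i)
  rw [latticeFreq, norm_mul, Real.norm_of_nonneg (by positivity), Real.norm_eq_abs]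
  nlinarith [Real.pi_gt_three]

theorem summable_norm_latticeFreq_inv_pow :
    Summable fun m : Fin n → ℤ => ‖latticeFreq m‖⁻¹ ^ (n + 1) := by
  set L := Submodule.span ℤ (Set.range (Pi.basisFun ℝ (Fin n)))
  have hL : Module.finrank ℤ L < n + 1 := by
    rw [ZLattice.rank ℝ L]
    simp
  have hmem : ∀ m : Fin n → ℤ, (fun i => (m i : ℝ)) ∈ L := by
    intro m
    have : (fun i => (m i : ℝ)) = ∑ i, m i • Pi.basisFun ℝ (Fin n) i := by
      ext j
      simp [Finset.sum_apply, Pi.single_apply]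
    rw [this]
    exact Submodule.sum_mem _ fun i _ =>
      Submodule.smul_mem _ _ (Submodule.subset_span (Set.mem_range_self i))
  have h := (ZLattice.summable_norm_pow_inv L (n + 1) hL).comp_injective
    (i := fun m : Fin n → ℤ => (⟨_, hmem m⟩ : L)) (fun m m' h => by
      ext i
      have := congrFun (congrArg Subtype.val h) i
      simpa using this)
  refine (h.mul_left ((2 * Real.pi)⁻¹ ^ (n + 1))).congr fun m => ?_
  rw [norm_latticeFreq, mul_inv (2 * Real.pi), mul_pow (2 * Real.pi)⁻¹]
  rfl

theorem exists_norm_pow_mul_norm_waveCoeff_le (hn : 1 ≤ n) {w : (Fin n → ℝ) → W}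
    (hw : ContDiff ℝ (⊤ : ℕ∞) w) (hper : IsIntPeriodic w) (p : ℕ) :
    ∃ C, ∀ m c, ‖latticeFreq m‖ ^ p * ‖waveCoeff w (latticeFreq m) c‖ ≤ C := by
  have : Nonempty (Fin n) := ⟨⟨0, hn⟩⟩
  have hb : ∀ i : Fin n, ∃ C, ∀ x ∈ Set.Icc (0 : Fin n → ℝ) 1,
      ‖partialDerivMulti (Pi.single i p) w x‖ ≤ C := fun i =>
    isCompact_Icc.exists_bound_of_continuousOn (hw.partialDerivMulti _).continuous.continuousOn
  choose C hC using hb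
  refine ⟨∑ i, |C i|, fun m c => ?_⟩
  obtain ⟨i, hi⟩ := Finite.exists_max fun i => ‖latticeFreq m i‖
  have hnorm : ‖latticeFreq m‖ = ‖latticeFreq m i‖ :=
    le_antisymm ((pi_norm_le_iff_of_nonneg (norm_nonneg _)).2 hi) (norm_le_pi_norm _ i)
  have h := waveCoeff_partialDerivMulti hw hper m (Pi.single i p) (c + p * (Real.pi / 2))
  have hprod : ∏ j, latticeFreq m j ^ (Pi.single i p : Fin n → ℕ) j = latticeFreq m i ^ p := by
    rw [Finset.prod_eq_single i (by intro b _ hb; simp [hb]) (by simp)]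
    simp
  rw [hprod, Finset.sum_pi_single', if_pos (Finset.mem_univ i), add_sub_cancel_right] at h
  calc ‖latticeFreq m‖ ^ p * ‖waveCoeff w (latticeFreq m) c‖
      = ‖waveCoeff (partialDerivMulti (Pi.single i p) w) (latticeFreq m)
          (c + p * (Real.pi / 2))‖ := by rw [h, norm_smul, norm_pow, hnorm]
    _ ≤ C i := norm_waveCoeff_le (hC i) _ _
    _ ≤ |C i| := le_abs_self _
    _ ≤ _ := Finset.single_le_sum (f := fun i => |C i|) (fun _ _ => abs_nonneg _)
        (Finset.mem_univ i)

/-- The Fourier coefficients of a smooth periodic function have finite moments. -/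
theorem summableMoments_waveCoeff (hn : 1 ≤ n) {w : (Fin n → ℝ) → W}
    (hw : ContDiff ℝ (⊤ : ℕ∞) w) (hper : IsIntPeriodic w) {J : Type*} [Finite J] (c : J → ℝ) :
    SummableMoments (fun j : J × (Fin n → ℤ) => latticeFreq j.2)
      fun j => waveCoeff w (latticeFreq j.2) (c j.1) := by
  intro p
  have key : ∀ c, Summable fun m : Fin n → ℤ =>
      ‖latticeFreq m‖ ^ p * ‖waveCoeff w (latticeFreq m) c‖ := by
    intro c
    obtain ⟨C, hC⟩ := exists_norm_pow_mul_norm_waveCoeff_le hn hw hper (p + (n + 1))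
    refine Summable.of_norm_bounded_eventually
      (summable_norm_latticeFreq_inv_pow.mul_left C) ?_
    refine (Set.finite_singleton (0 : Fin n → ℤ)).subset fun m hm => ?_
    by_contra hm0
    refine hm ?_
    rw [Set.mem_ofPred_eq]
    have h1 := one_le_norm_latticeFreq hm0
    rw [Real.norm_of_nonneg (by positivity), inv_pow, ← div_eq_mul_inv,
      le_div_iff₀ (by positivity)]
    refine le_trans (le_of_eq ?_) (hC m c)
    rw [pow_add]
    ring
  have := Fintype.ofFinite J
  refine (summable_prod_of_nonneg fun j => by positivity).2 ⟨fun j => key (c j), ?_⟩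
  exact Summable.of_finite

end Decay

section FourierInversion

variable {n : ℕ}

theorem IsIntPeriodic.eq_of_coe_eq {α : Type*} {g : (Fin n → ℝ) → α} (hper : IsIntPeriodic g)
    {x y : Fin n → ℝ} (h : ∀ i, (x i : UnitAddCircle) = y i) : g x = g y := by
  have : ∀ i, ∃ z : ℤ, x i = y i + z := by
    intro i
    have hi := h i
    rw [← sub_eq_zero, ← AddCircle.coe_sub, AddCircle.coe_eq_zero_iff] at hi
    obtain ⟨z, hz⟩ := hi
    refine ⟨z, ?_⟩
    rw [zsmul_one] at hz
    linarith
  choose z hz using this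
  rw [← hper y z]
  congr 1
  exact funext hz

theorem exists_continuousMap_unitAddTorus {g : (Fin n → ℝ) → ℂ} (hg : Continuous g)
    (hper : IsIntPeriodic g) :
    ∃ G : C(UnitAddTorus (Fin n), ℂ), ∀ x : Fin n → ℝ, G (fun i => (x i : UnitAddCircle)) = g x := by
  have hq : Topology.IsQuotientMap
      (⟨Pi.map fun _ x => (x : UnitAddCircle), by fun_prop⟩ :
        C(Fin n → ℝ, UnitAddTorus (Fin n))) :=
    (IsOpenQuotientMap.piMap (f := fun _ : Fin n => fun x : ℝ => (x : UnitAddCircle))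
      fun _ => QuotientAddGroup.isOpenQuotientMap_mk).isQuotientMap
  have hfac : Function.FactorsThrough (⟨g, hg⟩ : C(Fin n → ℝ, ℂ))
      (⟨Pi.map fun _ x => (x : UnitAddCircle), by fun_prop⟩ :
        C(Fin n → ℝ, UnitAddTorus (Fin n))) := fun x y h => hper.eq_of_coe_eq (congrFun h)
  refine ⟨hq.lift ⟨g, hg⟩ hfac, fun x => ?_⟩
  exact congrArg (fun F : C(Fin n → ℝ, ℂ) => F x) (hq.lift_comp ⟨g, hg⟩ hfac)

theorem mFourier_coe (m : Fin n → ℤ) (x : Fin n → ℝ) :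
    UnitAddTorus.mFourier m (fun i => (x i : UnitAddCircle)) =
      Complex.exp ((latticeFreq m ⬝ᵥ x : ℝ) * Complex.I) := by
  simp only [UnitAddTorus.mFourier, ContinuousMap.coe_mk, fourier_coe_apply, ← Complex.exp_sum]
  congr 1
  simp only [dotProduct, latticeFreq]
  push_cast
  rw [Finset.sum_mul]
  exact Finset.sum_congr rfl fun i _ => by ring

theorem mFourierCoeff_eq_waveCoeff {g : (Fin n → ℝ) → ℝ} (hg : Continuous g)
    {G : UnitAddTorus (Fin n) → ℂ}
    (hG : ∀ x : Fin n → ℝ, G (fun i => (x i : UnitAddCircle)) = g x) (m : Fin n → ℤ) :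
    UnitAddTorus.mFourierCoeff G m = waveCoeff g (latticeFreq m) 0 -
      waveCoeff g (latticeFreq m) (-(Real.pi / 2)) * Complex.I := by
  rw [UnitAddTorus.mFourierCoeff_eq_integral G m 0]
  have hset : {x : Fin n → ℝ | ∀ i, x i ∈ Set.Ioc ((0 : Fin n → ℝ) i) ((0 : Fin n → ℝ) i + 1)} =
      Set.univ.pi fun i => Set.Ioc ((0 : Fin n → ℝ) i) ((1 : Fin n → ℝ) i) := by
    ext x; simp [Set.mem_pi]
  rw [hset, volume_pi, setIntegral_congr_set Measure.univ_pi_Ioc_ae_eq_Icc, ← volume_pi]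
  have hpt : ∀ x : Fin n → ℝ, UnitAddTorus.mFourier (-m) (fun i => (x i : UnitAddCircle)) •
      G (fun i => (x i : UnitAddCircle)) =
      ((Real.cos (latticeFreq m ⬝ᵥ x + 0) • g x : ℝ) : ℂ) -
        ((Real.cos (latticeFreq m ⬝ᵥ x + -(Real.pi / 2)) • g x : ℝ) : ℂ) * Complex.I := by
    intro x
    rw [UnitAddTorus.mFourier_neg, mFourier_coe, hG, ← Complex.exp_conj, map_mul, Complex.conj_I,
      Complex.conj_ofReal, mul_neg, ← neg_mul, Complex.exp_mul_I, Complex.cos_neg, Complex.sin_neg,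
      ← sub_eq_add_neg, Real.cos_sub_pi_div_two, add_zero]
    push_cast [smul_eq_mul]
    ring
  simp only [hpt]
  rw [integral_sub (integrableOn_cos_smul hg _ _).ofReal
    ((integrableOn_cos_smul hg _ _).ofReal.mul_const _), integral_mul_const,
    integral_complex_ofReal, integral_complex_ofReal]
  rfl

theorem hasSum_cos_mul_waveCoeff {g : (Fin n → ℝ) → ℝ} (hg : Continuous g)
    (hper : IsIntPeriodic g)
    (hsum : ∀ c, Summable fun m : Fin n → ℤ => waveCoeff g (latticeFreq m) c) (x : Fin n → ℝ) :
    HasSum (fun m : Fin n → ℤ =>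
      Real.cos (latticeFreq m ⬝ᵥ x + 0) * waveCoeff g (latticeFreq m) 0 +
      Real.cos (latticeFreq m ⬝ᵥ x + -(Real.pi / 2)) *
        waveCoeff g (latticeFreq m) (-(Real.pi / 2))) (g x) := by
  obtain ⟨G, hG⟩ := exists_continuousMap_unitAddTorus (g := fun x => (g x : ℂ))
    (Complex.continuous_ofReal.comp hg) fun x z => congrArg _ (hper x z)
  have hcoeff := mFourierCoeff_eq_waveCoeff hg hG
  have hs : Summable (UnitAddTorus.mFourierCoeff G) := by
    simp only [funext_iff.2 hcoeff]
    exact (Complex.ofRealCLM.summable (hsum 0)).sub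
      ((Complex.ofRealCLM.summable (hsum (-(Real.pi / 2)))).mul_right _)
  have h := Complex.hasSum_re (UnitAddTorus.hasSum_mFourier_series_apply_of_summable hs
    fun i => (x i : UnitAddCircle))
  rw [hG, Complex.ofReal_re] at h
  refine h.congr_fun fun m => ?_
  rw [hcoeff, mFourier_coe, Complex.exp_mul_I, ← sub_eq_add_neg, Real.cos_sub_pi_div_two, add_zero]
  generalize latticeFreq m ⬝ᵥ x = θ
  simp [Complex.cos_ofReal_re, Complex.sin_ofReal_re]
  ring

/-- Fourier inversion for smooth periodic functions, in real form. -/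
theorem waveSeries_waveCoeff {W : Type*} [NormedAddCommGroup W] [InnerProductSpace ℝ W]
    [CompleteSpace W] (hn : 1 ≤ n) {w : (Fin n → ℝ) → W}
    (hw : ContDiff ℝ (⊤ : ℕ∞) w) (hper : IsIntPeriodic w) :
    waveSeries (fun j : Bool × (Fin n → ℤ) => latticeFreq j.2)
      (fun j => if j.1 then 0 else -(Real.pi / 2))
      (fun j => waveCoeff w (latticeFreq j.2) (if j.1 then 0 else -(Real.pi / 2))) = w := by
  ext x
  refine ext_inner_left ℝ fun a => ?_
  set φ := innerSL ℝ a
  change φ _ = φ (w x)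
  have hmom := summableMoments_waveCoeff hn hw hper
    (fun b : Bool => if b then 0 else -(Real.pi / 2))
  have hco : ∀ m c, waveCoeff (fun x => φ (w x)) (latticeFreq m) c =
      φ (waveCoeff w (latticeFreq m) c) := by
    intro m c
    simp only [waveCoeff]
    rw [← ContinuousLinearMap.integral_comp_comm _ (integrableOn_cos_smul hw.continuous _ _)]
    simp
  have hsum : ∀ c, Summable fun m : Fin n → ℤ =>
      waveCoeff (fun x => φ (w x)) (latticeFreq m) c := by
    intro c
    have h := summableMoments_waveCoeff hn hw hper (fun _ : Unit => c) 0
    simp only [pow_zero, one_mul] at h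
    have h' : Summable fun m : Fin n → ℤ => waveCoeff w (latticeFreq m) c :=
      h.of_norm.comp_injective (i := fun m => ((), m)) (Prod.mk_right_injective ())
    simp only [hco]
    exact φ.summable h'
  have h1 := hasSum_cos_mul_waveCoeff (g := fun x => φ (w x)) (φ.continuous.comp hw.continuous)
    (fun x z => congrArg φ (hper x z)) hsum x
  have h2 := (hmom.summable_planeWave
    (fun j => if j.1 then 0 else -(Real.pi / 2)) x).hasSum.map φ φ.continuous
  have h3 := ((Equiv.prodComm (Fin n → ℤ) Bool).hasSum_iff.2 h2).prod_fiberwise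
    fun m => hasSum_fintype _
  refine h3.unique (h1.congr_fun fun m => ?_)
  simp [planeWave, hco]

end FourierInversion

section Symbol

variable {n : ℕ} {V W : Type*} [NormedAddCommGroup V] [NormedSpace ℝ V]
  [NormedAddCommGroup W] [NormedSpace ℝ W]

theorem symbolOf_smul (k : ℕ) (coef : (Fin n → ℕ) → (V →ₗ[ℝ] W)) (t : ℝ) (ξ : Fin n → ℝ) :
    symbolOf k coef (t • ξ) = t ^ k • symbolOf k coef ξ := by
  simp only [symbolOf, Finset.smul_sum]
  refine Finset.sum_congr rfl fun α hα => ?_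
  rw [Finset.Nat.mem_antidiagonalTuple] at hα
  simp only [Pi.smul_apply, smul_eq_mul, mul_pow, Finset.prod_mul_distrib,
    Finset.prod_pow_eq_pow_sum, hα, mul_smul]

theorem continuous_symbolOf [FiniteDimensional ℝ V] (k : ℕ) (coef : (Fin n → ℕ) → (V →ₗ[ℝ] W)) :
    Continuous fun ξ => LinearMap.toContinuousLinearMap (symbolOf k coef ξ) := by
  simp only [symbolOf, map_sum, map_smul]
  fun_prop

/-- A continuous family of linear maps has bounded right inverses near a point where its rank is
locally constant. -/
theorem eventually_exists_preimage_norm_le {Y : Type*} [TopologicalSpace Y]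
    [FiniteDimensional ℝ V] [FiniteDimensional ℝ W]
    {T : Y → V →L[ℝ] W} {y₀ : Y} (hT : ContinuousAt T y₀)
    (hrank : ∀ᶠ y in nhds y₀, Module.finrank ℝ (LinearMap.range (T y : V →ₗ[ℝ] W)) =
      Module.finrank ℝ (LinearMap.range (T y₀ : V →ₗ[ℝ] W))) :
    ∃ C, ∀ᶠ y in nhds y₀, ∀ v, ∃ v', T y v' = T y v ∧ ‖v'‖ ≤ C * ‖T y v‖ := by
  obtain ⟨U, hU⟩ := Submodule.exists_isCompl (LinearMap.ker (T y₀ : V →ₗ[ℝ] W))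
  have hinj : LinearMap.ker ((T y₀ : V →ₗ[ℝ] W).domRestrict U) = ⊥ := by
    rw [LinearMap.ker_domRestrict, ← Submodule.disjoint_iff_comap_eq_bot]
    exact hU.disjoint.symm
  obtain ⟨K, hK, hanti⟩ := LinearMap.exists_antilipschitzWith _ hinj
  have hfin : Module.finrank ℝ U = Module.finrank ℝ (LinearMap.range (T y₀ : V →ₗ[ℝ] W)) := by
    have h1 := Submodule.finrank_add_eq_of_isCompl hU
    have h2 := LinearMap.finrank_range_add_finrank_ker (T y₀ : V →ₗ[ℝ] W)
    omega
  have hK' : (0 : ℝ) < K := by exact_mod_cast hK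
  have hnear := Metric.tendsto_nhds.1 hT (1 / (2 * K)) (by positivity)
  refine ⟨2 * K, ?_⟩
  filter_upwards [hrank, hnear] with y hy hd v
  have hbound : ∀ u : U, ‖(u : V)‖ ≤ 2 * K * ‖T y u‖ := by
    intro u
    have h1 : ‖(u : V)‖ ≤ K * ‖T y₀ u‖ := by
      simpa [dist_eq_norm] using hanti.le_mul_dist u 0
    have h2 : ‖(T y - T y₀) u‖ ≤ 1 / (2 * K) * ‖(u : V)‖ := by
      rw [dist_eq_norm] at hd
      exact (T y - T y₀).le_of_opNorm_le hd.le _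
    have h3 : ‖T y₀ u‖ ≤ ‖T y u‖ + ‖(T y - T y₀) u‖ := by
      have : T y₀ u = T y u - (T y - T y₀) u := by simp
      rw [this]
      exact norm_sub_le _ _
    have h4 : K * (1 / (2 * K) * ‖(u : V)‖) = ‖(u : V)‖ / 2 := by field_simp
    nlinarith [mul_le_mul_of_nonneg_left h2 hK'.le, mul_le_mul_of_nonneg_left h3 hK'.le]
  have hinj' : Function.Injective ((T y : V →ₗ[ℝ] W).domRestrict U) := by
    rw [← LinearMap.ker_eq_bot, LinearMap.ker_eq_bot']
    intro u hu
    have := hbound u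
    rw [show T y u = 0 from hu] at this
    simpa using this
  have hrange : LinearMap.range ((T y : V →ₗ[ℝ] W).domRestrict U) =
      LinearMap.range (T y : V →ₗ[ℝ] W) := by
    refine Submodule.eq_of_le_of_finrank_eq ?_ ?_
    · rintro _ ⟨u, rfl⟩
      exact ⟨u, rfl⟩
    · rw [LinearMap.finrank_range_of_inj hinj', hfin, hy]
  have hv : T y v ∈ LinearMap.range ((T y : V →ₗ[ℝ] W).domRestrict U) := by
    rw [hrange]
    exact ⟨v, rfl⟩
  obtain ⟨u, hu⟩ := hv
  have hu' : T y u = T y v := hu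
  exact ⟨u, hu', hu' ▸ hbound u⟩

/-- A symbol of constant rank has uniformly bounded right inverses at frequencies `‖ξ‖ ≥ 1`. -/
theorem exists_symbolOf_preimage_norm_le [FiniteDimensional ℝ V] [FiniteDimensional ℝ W] (k : ℕ)
    (coef : (Fin n → ℕ) → (V →ₗ[ℝ] W)) {s : ℕ} (hrank : ∀ ξ : Fin n → ℝ, ξ ≠ 0 →
      Module.finrank ℝ (LinearMap.range (symbolOf k coef ξ)) = s) :
    ∃ C, ∀ ξ : Fin n → ℝ, 1 ≤ ‖ξ‖ → ∀ w ∈ LinearMap.range (symbolOf k coef ξ),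
      ∃ v, symbolOf k coef ξ v = w ∧ ‖v‖ ≤ C * ‖w‖ := by
  have hsphere : ∃ C, 0 ≤ C ∧ ∀ ξ ∈ Metric.sphere (0 : Fin n → ℝ) 1, ∀ v, ∃ v',
      symbolOf k coef ξ v' = symbolOf k coef ξ v ∧ ‖v'‖ ≤ C * ‖symbolOf k coef ξ v‖ := by
    refine (isCompact_sphere (0 : Fin n → ℝ) 1).induction_on
      (p := fun S => ∃ C, 0 ≤ C ∧ ∀ ξ ∈ S, ∀ v, ∃ v',
        symbolOf k coef ξ v' = symbolOf k coef ξ v ∧ ‖v'‖ ≤ C * ‖symbolOf k coef ξ v‖)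
      ⟨0, le_rfl, by simp⟩ ?_ ?_ ?_
    · rintro S S' hS ⟨C, hC0, hC⟩
      exact ⟨C, hC0, fun ξ hξ => hC ξ (hS hξ)⟩
    · rintro S S' ⟨C, hC0, hC⟩ ⟨C', hC0', hC'⟩
      refine ⟨max C C', le_max_of_le_left hC0, fun ξ hξ v => ?_⟩
      rcases hξ with hξ | hξ
      · obtain ⟨v', h1, h2⟩ := hC ξ hξ v
        exact ⟨v', h1, h2.trans (by gcongr; exact le_max_left _ _)⟩
      · obtain ⟨v', h1, h2⟩ := hC' ξ hξ v
        exact ⟨v', h1, h2.trans (by gcongr; exact le_max_right _ _)⟩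
    · intro ξ hξ
      have hξ0 : ξ ≠ 0 := ne_zero_of_mem_unit_sphere ⟨ξ, hξ⟩
      obtain ⟨C, hC⟩ := eventually_exists_preimage_norm_le
        (continuous_symbolOf k coef).continuousAt (y₀ := ξ) (by
          filter_upwards [isOpen_ne.mem_nhds hξ0] with ζ hζ
          exact (hrank ζ hζ).trans (hrank ξ hξ0).symm)
      refine ⟨_, nhdsWithin_le_nhds hC, |C|, abs_nonneg C, fun ζ hζ v => ?_⟩
      obtain ⟨v', h1, h2⟩ := hζ v
      exact ⟨v', h1, h2.trans (mul_le_mul_of_nonneg_right (le_abs_self C) (norm_nonneg _))⟩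
  obtain ⟨C, hC0, hC⟩ := hsphere
  refine ⟨C, fun ξ hξ w hw => ?_⟩
  obtain ⟨v, rfl⟩ := hw
  have hpos : 0 < ‖ξ‖ := one_pos.trans_le hξ
  have hsm : symbolOf k coef ξ = ‖ξ‖ ^ k • symbolOf k coef (‖ξ‖⁻¹ • ξ) := by
    rw [← symbolOf_smul, smul_inv_smul₀ hpos.ne']
  obtain ⟨v', h1, h2⟩ := hC (‖ξ‖⁻¹ • ξ) (by simp [norm_smul, hpos.ne']) v
  refine ⟨v', by rw [hsm]; simp [h1], h2.trans ?_⟩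
  gcongr
  rw [hsm, LinearMap.smul_apply, norm_smul, norm_pow, norm_norm]
  exact le_mul_of_one_le_left (norm_nonneg _) (one_le_pow₀ hξ)

end Symbol

section Potential

variable {n : ℕ} {V W X : Type*} [NormedAddCommGroup V] [NormedSpace ℝ V] [FiniteDimensional ℝ V]
  [NormedAddCommGroup W] [InnerProductSpace ℝ W]
  [NormedAddCommGroup X] [NormedSpace ℝ X]

/-- A wave series whose amplitudes have controlled preimages under the symbol has a smooth
potential, all of whose derivatives are bounded. -/
theorem SummableMoments.exists_potential {J : Type*} {ξ : J → Fin n → ℝ} {a : J → W}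
    (h : SummableMoments ξ a) {l : ℕ} {coef : (Fin n → ℕ) → (V →ₗ[ℝ] W)} {C : ℝ}
    (hb : ∀ j, ∃ b, symbolOf l coef (ξ j) b = a j ∧ ‖b‖ ≤ C * ‖a j‖) (c : J → ℝ) :
    ∃ u : (Fin n → ℝ) → V, ContDiff ℝ (⊤ : ℕ∞) u ∧
      (∀ p, ∃ C, ∀ x, ‖iteratedFDeriv ℝ p u x‖ ≤ C) ∧ diffOp l coef u = waveSeries ξ c a := by
  have : CompleteSpace V := FiniteDimensional.complete ℝ V
  choose b hb1 hb2 using hb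
  have hbm : SummableMoments ξ b := h.of_norm_le hb2
  refine ⟨waveSeries ξ (fun j => c j - l * (Real.pi / 2)) b, hbm.contDiff_waveSeries _,
    fun p => ⟨_, hbm.norm_iteratedFDeriv_waveSeries_le _ p⟩, ?_⟩
  rw [hbm.diffOp_waveSeries]
  simp only [sub_add_cancel, hb1]

/-- A smooth periodic field of zero mean annihilated by `A` has a smooth potential for `B`, all of
whose derivatives are bounded. -/
theorem exists_smooth_potential [FiniteDimensional ℝ W] [FiniteDimensional ℝ X] (hn : 1 ≤ n) {k l : ℕ} {Acoef : (Fin n → ℕ) → (W →ₗ[ℝ] X)}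
    {Bcoef : (Fin n → ℕ) → (V →ₗ[ℝ] W)}
    (hBrank : ∃ s : ℕ, ∀ ξ : Fin n → ℝ, ξ ≠ 0 →
      Module.finrank ℝ (LinearMap.range (symbolOf l Bcoef ξ)) = s)
    (hexact : ∀ ξ : Fin n → ℝ, ξ ≠ 0 →
      LinearMap.ker (symbolOf k Acoef ξ) = LinearMap.range (symbolOf l Bcoef ξ))
    {w : (Fin n → ℝ) → W} (hw : ContDiff ℝ (⊤ : ℕ∞) w) (hper : IsIntPeriodic w)
    (hA : ∀ x, diffOp k Acoef w x = 0) (hmean : ∫ x in Set.Icc (0 : Fin n → ℝ) 1, w x = 0) :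
    ∃ u : (Fin n → ℝ) → V, ContDiff ℝ (⊤ : ℕ∞) u ∧
      (∀ p, ∃ C, ∀ x, ‖iteratedFDeriv ℝ p u x‖ ≤ C) ∧ diffOp l Bcoef u = w := by
  obtain ⟨s, hs⟩ := hBrank
  obtain ⟨C, hC⟩ := exists_symbolOf_preimage_norm_le l Bcoef hs
  set θ : Bool → ℝ := fun b => if b then 0 else -(Real.pi / 2) with hθ
  have hinv := waveSeries_waveCoeff hn hw hper
  have hmom := summableMoments_waveCoeff hn hw hper θ
  have hb : ∀ j : Bool × (Fin n → ℤ), ∃ b : V,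
      symbolOf l Bcoef (latticeFreq j.2) b = waveCoeff w (latticeFreq j.2) (θ j.1) ∧
        ‖b‖ ≤ C * ‖waveCoeff w (latticeFreq j.2) (θ j.1)‖ := by
    rintro ⟨j, m⟩
    by_cases hm : m = 0
    · have h0 : waveCoeff w (latticeFreq m) (θ j) = 0 := by
        rw [latticeFreq_eq_zero.2 hm]
        simp only [waveCoeff, zero_dotProduct, integral_smul, hmean, smul_zero]
      exact ⟨0, by simp [h0]⟩
    · have hm1 := one_le_norm_latticeFreq hm
      refine hC _ hm1 _ ?_
      rw [← hexact _ (fun h => hm (latticeFreq_eq_zero.1 h)), LinearMap.mem_ker]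
      have h := waveCoeff_diffOp hw hper m k Acoef (θ j + k * (Real.pi / 2))
      rw [add_sub_cancel_right] at h
      rw [← h]
      simp [waveCoeff, hA]
  rw [← hinv]
  exact hmom.exists_potential hb _

end Potential

section UniformlySmooth

variable {ι E F : Type*} [NormedAddCommGroup E] [NormedSpace ℝ E] [NormedAddCommGroup F]
  [NormedSpace ℝ F]

/-- A family of smooth functions all of whose derivatives are bounded, uniformly in the family. -/
def UniformlySmooth (f : ι → E → F) : Prop :=
  (∀ N, ContDiff ℝ (⊤ : ℕ∞) (f N)) ∧ ∀ p, ∃ C, ∀ N x, ‖iteratedFDeriv ℝ p (f N) x‖ ≤ C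

namespace UniformlySmooth

theorem const {f : E → F} (hf : ContDiff ℝ (⊤ : ℕ∞) f)
    (hb : ∀ p, ∃ C, ∀ x, ‖iteratedFDeriv ℝ p f x‖ ≤ C) : UniformlySmooth fun _ : ι => f :=
  ⟨fun _ => hf, fun p => (hb p).imp fun _ h _ => h⟩

theorem norm_le {f : ι → E → F} (hf : UniformlySmooth f) : ∃ C, ∀ N x, ‖f N x‖ ≤ C := by
  simpa using hf.2 0

theorem smul {φ : ι → E → ℝ} {f : ι → E → F} (hφ : UniformlySmooth φ) (hf : UniformlySmooth f) :
    UniformlySmooth fun N x => φ N x • f N x := by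
  refine ⟨fun N => (hφ.1 N).smul (hf.1 N), fun p => ?_⟩
  choose C hC using hφ.2
  choose D hD using hf.2
  refine ⟨∑ i ∈ Finset.range (p + 1), (p.choose i : ℝ) * |C i| * |D (p - i)|, fun N x => ?_⟩
  refine (norm_iteratedFDeriv_smul_le (hφ.1 N) (hf.1 N) x (by exact_mod_cast le_top)).trans ?_
  gcongr with i _
  · exact (hC i N x).trans (le_abs_self _)
  · exact (hD (p - i) N x).trans (le_abs_self _)

theorem prod {J : Type*} {φ : J → ι → E → ℝ} (hφ : ∀ j, UniformlySmooth (φ j)) (s : Finset J) :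
    UniformlySmooth fun N x => ∏ j ∈ s, φ j N x := by
  classical
  induction s using Finset.induction_on with
  | empty =>
    simp only [Finset.prod_empty]
    refine const contDiff_const fun p => ?_
    rcases eq_or_ne p 0 with rfl | hp
    · exact ⟨1, by simp⟩
    · exact ⟨0, by simp [iteratedFDeriv_const_of_ne hp]⟩
  | insert j s hj ih =>
    simpa only [Finset.prod_insert hj, smul_eq_mul] using (hφ j).smul ih

theorem comp_affine {ψ : ℝ → F} (hψ : ContDiff ℝ (⊤ : ℕ∞) ψ)
    (hb : ∀ p, ∃ C, ∀ t, ‖iteratedFDeriv ℝ p ψ t‖ ≤ C) (L : E →L[ℝ] ℝ) (b : ι → ℝ) :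
    UniformlySmooth fun N x => ψ (L x + b N) := by
  have hsm : ∀ N, ContDiff ℝ (⊤ : ℕ∞) fun t => ψ (t + b N) := fun N =>
    hψ.comp (contDiff_id.add contDiff_const)
  refine ⟨fun N => (hsm N).comp L.contDiff, fun p => ?_⟩
  obtain ⟨C, hC⟩ := hb p
  refine ⟨C * ‖L‖ ^ p, fun N x => ?_⟩
  have h := L.iteratedFDeriv_comp_right (hsm N) x (i := p) (by exact_mod_cast le_top)
  rw [Function.comp_def] at h
  rw [h]
  refine (ContinuousMultilinearMap.norm_compContinuousLinearMap_le _ _).trans ?_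
  rw [Finset.prod_const, Finset.card_univ, Fintype.card_fin, iteratedFDeriv_comp_add_right p (b N)]
  gcongr
  exact hC _

variable {n : ℕ}

theorem pderivI {f : ι → (Fin n → ℝ) → F} (hf : UniformlySmooth f) (i : Fin n) :
    UniformlySmooth fun N => pderivI i (f N) :=
  ⟨fun N => (hf.1 N).pderivI i, fun p => (hf.2 (p + 1)).imp fun _ h N x =>
    (norm_iteratedFDeriv_pderivI_le (hf.1 N) i p x).trans (h N x)⟩

theorem partialDerivMulti {f : ι → (Fin n → ℝ) → F} (hf : UniformlySmooth f) (α : Fin n → ℕ) :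
    UniformlySmooth fun N => partialDerivMulti α (f N) :=
  partialDerivMulti_induction (P := fun _ g => UniformlySmooth g) f hf
    (fun _ i _ hg => hg.pderivI i) α

theorem norm_diffOp_le [FiniteDimensional ℝ F] {X : Type*} [NormedAddCommGroup X] [NormedSpace ℝ X]
    {f : ι → (Fin n → ℝ) → F} (hf : UniformlySmooth f) (l : ℕ)
    (coef : (Fin n → ℕ) → (F →ₗ[ℝ] X)) : ∃ C, ∀ N x, ‖diffOp l coef (f N) x‖ ≤ C := by
  choose C hC using fun α => (hf.partialDerivMulti α).norm_le
  refine ⟨∑ α ∈ Finset.Nat.antidiagonalTuple n l,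
    ‖LinearMap.toContinuousLinearMap (coef α)‖ * C α, fun N x => norm_sum_le_of_le _ fun α _ => ?_⟩
  exact (LinearMap.toContinuousLinearMap (coef α)).le_opNorm_of_le (hC α N x)

end UniformlySmooth

end UniformlySmooth

section Cutoff

theorem exists_norm_iteratedFDeriv_smoothTransition_le (p : ℕ) :
    ∃ C, ∀ t, ‖iteratedFDeriv ℝ p Real.smoothTransition t‖ ≤ C := by
  rcases eq_or_ne p 0 with rfl | hp
  · exact ⟨1, fun t => by
      simpa [abs_of_nonneg (Real.smoothTransition.nonneg t)] using Real.smoothTransition.le_one t⟩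
  have hcont : Continuous (iteratedFDeriv ℝ p Real.smoothTransition) :=
    (Real.smoothTransition.contDiff (n := ⊤)).continuous_iteratedFDeriv (by exact_mod_cast le_top)
  obtain ⟨C, hC⟩ := (isCompact_Icc (a := (0 : ℝ)) (b := 1)).exists_bound_of_continuousOn
    hcont.continuousOn
  have hC0 : 0 ≤ C := (norm_nonneg _).trans (hC 0 (by simp))
  have hconst : ∀ (t c : ℝ), Real.smoothTransition =ᶠ[nhds t] (fun _ => c) →
      ‖iteratedFDeriv ℝ p Real.smoothTransition t‖ ≤ C := by
    intro t c h
    rw [(h.iteratedFDeriv ℝ p).self_of_nhds, iteratedFDeriv_const_of_ne hp]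
    simpa using hC0
  refine ⟨C, fun t => ?_⟩
  rcases lt_or_ge t 0 with ht | ht
  · exact hconst t 0 (by
      filter_upwards [gt_mem_nhds ht] with s hs
      exact Real.smoothTransition.zero_of_nonpos hs.le)
  rcases lt_or_ge 1 t with ht1 | ht1
  · exact hconst t 1 (by
      filter_upwards [lt_mem_nhds ht1] with s hs
      exact Real.smoothTransition.one_of_one_le hs.le)
  exact hC t ⟨ht, ht1⟩

variable {n : ℕ}

/-- A smooth cut-off of the cube `(0, N)^n`, with transition layers of unit width. -/
noncomputable def cubeCutoff (n N : ℕ) (y : Fin n → ℝ) : ℝ :=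
  ∏ i, (Real.smoothTransition (y i - 1) * Real.smoothTransition (N - 1 - y i))

theorem uniformlySmooth_cubeCutoff : UniformlySmooth (cubeCutoff n) := by
  refine UniformlySmooth.prod (fun i => ?_) Finset.univ
  have h1 := UniformlySmooth.comp_affine (ι := ℕ) (Real.smoothTransition.contDiff (n := ⊤))
    exists_norm_iteratedFDeriv_smoothTransition_le
    (ContinuousLinearMap.proj (R := ℝ) (φ := fun _ : Fin n => ℝ) i) (fun _ => -1)
  have h2 := UniformlySmooth.comp_affine (ι := ℕ) (Real.smoothTransition.contDiff (n := ⊤))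
    exists_norm_iteratedFDeriv_smoothTransition_le
    (-ContinuousLinearMap.proj (R := ℝ) (φ := fun _ : Fin n => ℝ) i) (fun N => N - 1)
  refine (congrArg UniformlySmooth ?_).mpr (h1.smul h2)
  funext N y
  rw [smul_eq_mul, neg_apply, ContinuousLinearMap.proj_apply]
  ring_nf

theorem cubeCutoff_eq_zero {N : ℕ} {y : Fin n → ℝ} {i : Fin n} (h : y i ≤ 1 ∨ N - 1 ≤ y i) :
    cubeCutoff n N y = 0 := by
  refine Finset.prod_eq_zero (Finset.mem_univ i) ?_
  rcases h with h | h
  · rw [Real.smoothTransition.zero_of_nonpos (by linarith), zero_mul]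
  · rw [Real.smoothTransition.zero_of_nonpos (x := N - 1 - y i) (by linarith), mul_zero]

theorem cubeCutoff_eq_one {N : ℕ} {y : Fin n → ℝ} (h : ∀ i, 2 ≤ y i ∧ y i ≤ N - 2) :
    cubeCutoff n N y = 1 := by
  refine Finset.prod_eq_one fun i _ => ?_
  rw [Real.smoothTransition.one_of_one_le (by linarith [(h i).1]),
    Real.smoothTransition.one_of_one_le (by linarith [(h i).2]), one_mul]

variable {V W : Type*} [NormedAddCommGroup V] [NormedSpace ℝ V] [FiniteDimensional ℝ V]
  [NormedAddCommGroup W] [NormedSpace ℝ W]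

/-- The rescaled and cut-off copies `v N` of a potential `u` are test functions on the unit cube,
their images under the operator are bounded, and on compact subsets of the cube they eventually
agree with the rescaled copies of the image of `u`. -/
theorem exists_cutoff_sequence {l : ℕ} (coef : (Fin n → ℕ) → (V →ₗ[ℝ] W)) {u : (Fin n → ℝ) → V}
    (hu : ContDiff ℝ (⊤ : ℕ∞) u) (hb : ∀ p, ∃ C, ∀ x, ‖iteratedFDeriv ℝ p u x‖ ≤ C) :
    ∃ v : ℕ → (Fin n → ℝ) → V, (∀ N, ContDiff ℝ (⊤ : ℕ∞) (v N)) ∧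
      (∀ N, 0 < N → tsupport (v N) ⊆ openUnitCube n) ∧
      (∃ R, ∀ N, 0 < N → ∀ x, ‖diffOp l coef (v N) x‖ ≤ R) ∧
      ∀ x ∈ openUnitCube n, ∀ᶠ N : ℕ in Filter.atTop,
        diffOp l coef (v N) x = diffOp l coef u ((N : ℝ) • x) := by
  set g : ℕ → (Fin n → ℝ) → V := fun N y => cubeCutoff n N y • u y with hg
  have hgs : UniformlySmooth g := uniformlySmooth_cubeCutoff.smul (UniformlySmooth.const hu hb)
  have hBv : ∀ N : ℕ, 0 < N → ∀ x, diffOp l coef (fun y => ((N : ℝ) ^ l)⁻¹ • g N ((N : ℝ) • y)) x =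
      diffOp l coef (g N) ((N : ℝ) • x) := by
    intro N hN x
    have hN' : (N : ℝ) ^ l ≠ 0 := by positivity
    rw [diffOp_comp_smul l coef (hgs.1 N), inv_mul_cancel₀ hN', one_smul]
  refine ⟨fun N y => ((N : ℝ) ^ l)⁻¹ • g N ((N : ℝ) • y), fun N => ?_, fun N hN => ?_, ?_, ?_⟩
  · exact ((hgs.1 N).comp (contDiff_id.const_smul (N : ℝ))).const_smul _
  · have hN' : (0 : ℝ) < N := by exact_mod_cast hN
    have hcl : IsClosed (Set.univ.pi fun _ : Fin n => Set.Icc (1 / N : ℝ) (1 - 1 / N)) :=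
      isClosed_set_pi fun _ _ => isClosed_Icc
    refine (closure_minimal ?_ hcl).trans (Set.pi_mono fun i _ => ?_)
    · intro x hx i _
      by_contra hi
      refine hx ?_
      have h0 : cubeCutoff n N ((N : ℝ) • x) = 0 := by
        refine cubeCutoff_eq_zero (i := i) ?_
        rw [Set.mem_Icc, not_and_or, not_le, not_le, lt_div_iff₀ hN'] at hi
        rw [Pi.smul_apply, smul_eq_mul]
        refine hi.imp (fun h => by linarith) fun h => ?_
        have := mul_lt_mul_of_pos_left h hN'
        rw [mul_sub, mul_one_div_cancel hN'.ne'] at this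
        linarith
      simp [hg, h0]
    · have : (0 : ℝ) < 1 / N := by positivity
      exact Set.Icc_subset_Ioo this (by linarith)
  · obtain ⟨R, hR⟩ := hgs.norm_diffOp_le l coef
    exact ⟨R, fun N hN x => (hBv N hN x).symm ▸ hR N _⟩
  · intro x hx
    have hev : ∀ i, ∀ᶠ N : ℕ in Filter.atTop, 2 < N * x i ∧ N * x i < N - 2 := by
      intro i
      have h1 : 0 < x i := (hx i trivial).1
      have h2 : 0 < 1 - x i := by linarith [(hx i trivial).2]
      have ht := tendsto_natCast_atTop_atTop (R := ℝ)
      filter_upwards [(ht.atTop_mul_const h1).eventually_gt_atTop 2,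
        (ht.atTop_mul_const h2).eventually_gt_atTop 2] with N hN1 hN2
      exact ⟨hN1, by linarith⟩
    filter_upwards [Filter.eventually_all.2 hev, Filter.eventually_gt_atTop 0] with N hN hN0
    rw [hBv N hN0]
    refine diffOp_eq_of_eventuallyEq l coef ?_
    have hopen : IsOpen (Set.univ.pi fun _ : Fin n => Set.Ioo (2 : ℝ) (N - 2)) :=
      isOpen_set_pi Set.finite_univ fun _ _ => isOpen_Ioo
    filter_upwards [hopen.mem_nhds (x := (N : ℝ) • x) fun i _ => hN i] with y hy
    simp only [hg]
    rw [cubeCutoff_eq_one fun i => ⟨(hy i trivial).1.le, (hy i trivial).2.le⟩, one_smul]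

end Cutoff

section TorusMeasure

variable {n : ℕ}

/-- The quotient map from the half-open unit cube onto the torus preserves the measure. -/
theorem measurePreserving_coe_cube :
    MeasurePreserving (fun (x : Fin n → ℝ) i => (x i : UnitAddCircle))
      (volume.restrict (Set.Icc (0 : Fin n → ℝ) 1))
      (Measure.pi fun _ => (volume : Measure UnitAddCircle)) := by
  have h := measurePreserving_pi (ι := Fin n) _ _ fun _ => AddCircle.measurePreserving_mk 1 0
  rwa [← Measure.restrict_pi_pi, ← volume_pi, zero_add,
    Measure.restrict_congr_set (t := Set.Icc 0 1)
      (Measure.univ_pi_Ioc_ae_eq_Icc (f := fun _ => 0) (g := fun _ => 1))] at h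

/-- The mean of a periodic function over the unit cube is unchanged by integer dilations. -/
theorem IsIntPeriodic.setIntegral_comp_smul {F : (Fin n → ℝ) → ℝ} (hF : IsIntPeriodic F)
    (hm : Measurable F) {N : ℕ} (hN : 0 < N) :
    ∫ x in Set.Icc (0 : Fin n → ℝ) 1, F ((N : ℝ) • x) =
      ∫ x in Set.Icc (0 : Fin n → ℝ) 1, F x := by
  set μ : Measure (Fin n → UnitAddCircle) := Measure.pi fun _ => volume
  let G : (Fin n → UnitAddCircle) → ℝ := fun y =>
    F fun i => (AddCircle.measurableEquivIoc 1 0 (y i) : ℝ)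
  have hG : Measurable G := hm.comp <| measurable_pi_lambda _ fun i =>
    measurable_subtype_coe.comp
      ((AddCircle.measurableEquivIoc 1 0).measurable.comp (measurable_pi_apply i))
  have hGF : ∀ x : Fin n → ℝ, G (fun i => (x i : UnitAddCircle)) = F x := fun x =>
    hF.eq_of_coe_eq fun i => (AddCircle.equivIoc 1 0).symm_apply_apply (x i : UnitAddCircle)
  have hpow : MeasurePreserving (fun (y : Fin n → UnitAddCircle) i => (N : ℤ) • y i) μ μ :=
    measurePreserving_pi _ _ fun _ =>
      Measure.measurePreserving_zsmul (volume : Measure UnitAddCircle) (by exact_mod_cast hN.ne')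
  have key : ∀ {T : (Fin n → ℝ) → Fin n → UnitAddCircle},
      MeasurePreserving T (volume.restrict (Set.Icc (0 : Fin n → ℝ) 1)) μ →
      ∫ x in Set.Icc (0 : Fin n → ℝ) 1, G (T x) = ∫ y, G y ∂μ := fun hT => by
    rw [← hT.map_eq, integral_map hT.measurable.aemeasurable hG.aestronglyMeasurable]
  have h1 := key measurePreserving_coe_cube
  have h2 := key (hpow.comp measurePreserving_coe_cube)
  rw [← h1] at h2
  simp only [hGF] at h2
  rw [← h2]
  refine integral_congr_ae (.of_forall fun x => ?_)
  beta_reduce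
  rw [← hGF]
  simp

end TorusMeasure

/-- **Cut-off step in Corollary 3.2.** Let `A`, `B` be homogeneous constant-coefficient
linear differential operators of orders `k` and `l`, both of constant rank, with
`ker A(ξ) = im B(ξ)` for all `ξ ≠ 0`, and let `f : W → ℝ` be Borel measurable and
locally bounded. Then for every `η ∈ W`, every `ε > 0`, and every smooth `ℤ^n`-periodic
test field `w` with `A w = 0` and zero mean on the unit cube, there is
`v ∈ C_c^∞((0,1)^n, V)` with
`∫_{[0,1]^n} f(η + B v) ≤ ∫_{[0,1]^n} f(η + w) + ε`. -/
theorem exists_compactly_supported_potential_test_field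
    {n k l : ℕ} (hn : 1 ≤ n) (hk : 1 ≤ k) (hl : 1 ≤ l)
    {V W X : Type*}
    [NormedAddCommGroup V] [InnerProductSpace ℝ V] [FiniteDimensional ℝ V]
    [NormedAddCommGroup W] [InnerProductSpace ℝ W] [FiniteDimensional ℝ W]
    [MeasurableSpace W] [BorelSpace W]
    [NormedAddCommGroup X] [InnerProductSpace ℝ X] [FiniteDimensional ℝ X]
    (Acoef : (Fin n → ℕ) → (W →ₗ[ℝ] X)) (Bcoef : (Fin n → ℕ) → (V →ₗ[ℝ] W))
    (hArank : ∃ r : ℕ, ∀ ξ : Fin n → ℝ, ξ ≠ 0 →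
      Module.finrank ℝ (LinearMap.range (symbolOf k Acoef ξ)) = r)
    (hBrank : ∃ s : ℕ, ∀ ξ : Fin n → ℝ, ξ ≠ 0 →
      Module.finrank ℝ (LinearMap.range (symbolOf l Bcoef ξ)) = s)
    (hexact : ∀ ξ : Fin n → ℝ, ξ ≠ 0 →
      LinearMap.ker (symbolOf k Acoef ξ) = LinearMap.range (symbolOf l Bcoef ξ))
    (f : W → ℝ) (hf_meas : Measurable f)
    (hf_locbdd : ∀ R : ℝ, ∃ C : ℝ, ∀ η : W, ‖η‖ ≤ R → |f η| ≤ C)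
    (η : W) (ε : ℝ) (hε : 0 < ε)
    (w : (Fin n → ℝ) → W)
    (hw_smooth : ContDiff ℝ (⊤ : ℕ∞) w)
    (hw_per : ∀ (x : Fin n → ℝ) (z : Fin n → ℤ), w (x + fun i => (z i : ℝ)) = w x)
    (hw_Afree : ∀ x : Fin n → ℝ, diffOp k Acoef w x = 0)
    (hw_mean : (∫ x in Set.Icc (0 : Fin n → ℝ) 1, w x) = 0) :
    ∃ v : (Fin n → ℝ) → V, ContDiff ℝ (⊤ : ℕ∞) v ∧ tsupport v ⊆ openUnitCube n ∧
      (∫ x in Set.Icc (0 : Fin n → ℝ) 1, f (η + diffOp l Bcoef v x))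
        ≤ (∫ x in Set.Icc (0 : Fin n → ℝ) 1, f (η + w x)) + ε := by
  obtain ⟨u, hu, hub, huw⟩ := exists_smooth_potential hn hBrank hexact hw_smooth hw_per
    hw_Afree hw_mean
  obtain ⟨v, hv, hsupp, ⟨R, hR⟩, hlim⟩ := exists_cutoff_sequence (l := l) Bcoef hu hub
  rw [huw] at hlim
  set μ := volume.restrict (Set.Icc (0 : Fin n → ℝ) 1)
  have : IsFiniteMeasure μ := isFiniteMeasure_restrict.2 isCompact_Icc.measure_lt_top.ne
  have hcube : ∀ᵐ x ∂μ, x ∈ openUnitCube n := by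
    have h : μ = volume.restrict (openUnitCube n) :=
      (Measure.restrict_congr_set (Measure.univ_pi_Ioo_ae_eq_Icc (f := 0) (g := 1))).symm
    rw [h]
    exact ae_restrict_mem (MeasurableSet.univ_pi fun _ => measurableSet_Ioo)
  have hwb : ∃ S, ∀ x, ‖w x‖ ≤ S := by
    obtain ⟨S, hS⟩ := (UniformlySmooth.const (ι := Unit) hu hub).norm_diffOp_le l Bcoef
    exact ⟨S, fun x => huw ▸ hS () x⟩
  obtain ⟨S, hS⟩ := hwb
  obtain ⟨C, hC⟩ := hf_locbdd (‖η‖ + max R S)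
  have hCv : ∀ N, 0 < N → ∀ x, |f (η + diffOp l Bcoef (v N) x)| ≤ C := fun N hN x =>
    hC _ ((norm_add_le _ _).trans (by grw [hR N hN x, ← le_max_left]))
  have hCw : ∀ x, |f (η + w x)| ≤ C := fun x =>
    hC _ ((norm_add_le _ _).trans (by grw [hS x, ← le_max_right]))
  have hmv : ∀ N, Measurable fun x => f (η + diffOp l Bcoef (v N) x) := fun N =>
    hf_meas.comp (((hv N).diffOp l Bcoef).continuous.measurable.const_add η)
  have hmw : Measurable fun x => f (η + w x) :=
    hf_meas.comp (hw_smooth.continuous.measurable.const_add η)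
  have hmwN : ∀ N : ℕ, Measurable fun x : Fin n → ℝ => f (η + w ((N : ℝ) • x)) := fun N =>
    hmw.comp (measurable_const_smul (N : ℝ))
  have hiv : ∀ N, 0 < N → Integrable (fun x => f (η + diffOp l Bcoef (v N) x)) μ := fun N hN =>
    .of_bound (hmv N).aestronglyMeasurable C (.of_forall (hCv N hN))
  have hiw : ∀ N : ℕ, Integrable (fun x => f (η + w ((N : ℝ) • x))) μ := fun N =>
    .of_bound (hmwN N).aestronglyMeasurable C (.of_forall fun x => hCw _)
  have htend : Filter.Tendsto (fun N : ℕ => ∫ x, (f (η + diffOp l Bcoef (v (N + 1)) x) -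
      f (η + w (((N + 1 : ℕ) : ℝ) • x))) ∂μ) Filter.atTop (nhds (∫ _, (0 : ℝ) ∂μ)) := by
    refine tendsto_integral_of_dominated_convergence (fun _ => C + C)
      (fun N => ((hmv _).sub (hmwN _)).aestronglyMeasurable) (integrable_const _)
      (fun N => .of_forall fun x => (norm_sub_le _ _).trans
        (add_le_add (hCv _ N.succ_pos x) (hCw _))) ?_
    filter_upwards [hcube] with x hx
    refine tendsto_const_nhds.congr' ?_
    filter_upwards [(Filter.tendsto_add_atTop_nat 1).eventually (hlim x hx)] with N hN
    rw [hN, sub_self]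
  rw [integral_zero] at htend
  obtain ⟨N, hN⟩ := (htend.eventually_le_const hε).exists
  refine ⟨v (N + 1), hv _, hsupp _ N.succ_pos, ?_⟩
  have hper : IsIntPeriodic fun x => f (η + w x) := fun x z => by
    simp only [hw_per x z]
  rw [integral_sub (hiv _ N.succ_pos) (hiw _),
    hper.setIntegral_comp_smul hmw N.succ_pos] at hN
  linarith
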